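/- Let λ and μ be partitions, let n ∈ ℕ be such that λ_i = μ_i = 0 for all i > n, and let g ∈ ℕ satisfy g ≥ λ_1 and g ≥ μ_1. Let g::λ denote the partition (g, λ_1, λ_2, …, λ_n) and g::μ the partition (g, μ_1, μ_2, …, μ_n). Then S_{n+1}(g::λ, g::μ; 0) = S_n(λ, μ; −1). (In particular, the Schur function of a skew shape translated one step downwards equals the image of the original Schur function under the inverse of the shift automorphism φ.) -/

import Mathlib

/-- The base ring of the ninth variation: polynomials over `ℤ` in indeterminates
`X_{(r,s)}` indexed by pairs of a positive integer `r` and an integer `s`. -/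
abbrev NinthR : Type := MvPolynomial ({r : ℤ // 0 < r} × ℤ) ℤ

/-- `hfun r s` is `h_{r,s}`: the indeterminate `X_{(r,s)}` if `r > 0`, `1` if `r = 0`,
and `0` if `r < 0`. -/
noncomputable def hfun (r s : ℤ) : NinthR :=
  if hr : 0 < r then MvPolynomial.X (⟨r, hr⟩, s) else if r = 0 then 1 else 0

/-- The ninth-variation skew Schur function `S_n(λ,μ;s)`: the determinant of the
`n × n` matrix whose `(i,j)` entry (`1 ≤ i,j ≤ n`, here encoded by `Fin n` with the
`1`-based index `(i : ℕ) + 1`) is `h(λ_i − μ_j − i + j, μ_j − j + 1 + s)`.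
Partitions are encoded as functions `ℕ → ℕ` whose relevant values are at indices
`1, 2, 3, …`. -/
noncomputable def Svar (n : ℕ) (l m : ℕ → ℕ) (s : ℤ) : NinthR :=
  Matrix.det (Matrix.of fun i j : Fin n =>
    hfun ((l ((i : ℕ) + 1) : ℤ) - (m ((j : ℕ) + 1) : ℤ)
        - (((i : ℕ) : ℤ) + 1) + (((j : ℕ) : ℤ) + 1))
      ((m ((j : ℕ) + 1) : ℤ) - (((j : ℕ) : ℤ) + 1) + 1 + s))

/-- Prepend a part `g` to a partition `l` (encoded as a function `ℕ → ℕ` with relevant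
values at indices `1, 2, 3, …`): `(g::l)_1 = g` and `(g::l)_i = l_{i−1}` for `i ≥ 2`. -/
def consPart (g : ℕ) (l : ℕ → ℕ) : ℕ → ℕ := fun i => if i = 1 then g else l (i - 1)

theorem hfun_zero (s : ℤ) : hfun 0 s = 1 := by simp [hfun]

theorem hfun_of_neg {r : ℤ} (hr : r < 0) (s : ℤ) : hfun r s = 0 := by
  simp [hfun, hr.not_gt, hr.ne]

theorem part_le_of_first_le {l : ℕ → ℕ} (hl : ∀ i, 1 ≤ i → l (i + 1) ≤ l i) {g : ℕ}
    (hg : l 1 ≤ g) (i : ℕ) : l (i + 1) ≤ g := by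
  induction i with
  | zero => exact hg
  | succ i ih => exact (hl (i + 1) (Nat.le_add_left 1 i)).trans ih

theorem consPart_one (g : ℕ) (l : ℕ → ℕ) : consPart g l 1 = g := rfl

theorem consPart_add_two (g : ℕ) (l : ℕ → ℕ) (i : ℕ) :
    consPart g l (i + 1 + 1) = l (i + 1) := by
  simp [consPart]

/-- Translating a skew shape one step downwards applies `φ⁻¹`: if
`λ, μ` are partitions with parts vanishing beyond `n` and `g ≥ λ_1`, `g ≥ μ_1`, then
`S_{n+1}(g::λ, g::μ; 0) = S_n(λ, μ; −1)`. -/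
theorem stmt_18 (l μ : ℕ → ℕ)
    (hl : ∀ i, 1 ≤ i → l (i + 1) ≤ l i) (hμ : ∀ i, 1 ≤ i → μ (i + 1) ≤ μ i)
    (n : ℕ) (hn : ∀ i, n < i → l i = 0 ∧ μ i = 0)
    (g : ℕ) (hgl : l 1 ≤ g) (hgμ : μ 1 ≤ g) :
    Svar (n + 1) (consPart g l) (consPart g μ) 0 = Svar n l μ (-1) := by
  unfold Svar
  rw [Matrix.det_succ_column_zero, Fin.sum_univ_succ, Finset.sum_eq_zero, add_zero]
  · simp only [Matrix.of_apply, Fin.val_zero, Nat.cast_zero, zero_add, consPart_one, sub_self,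
      zero_sub, neg_add_cancel, hfun_zero, pow_zero, one_mul, Fin.succAbove_zero]
    congr 1
    ext1 i j
    simp only [Matrix.submatrix_apply, Matrix.of_apply, Fin.val_succ, consPart_add_two]
    congr 1 <;> push_cast <;> ring
  · intro i _
    have hi := part_le_of_first_le hl hgl i
    rw [Matrix.of_apply, hfun_of_neg, mul_zero, zero_mul]
    simp only [Fin.val_succ, Fin.val_zero, consPart_add_two, zero_add, consPart_one]
    push_cast
    omega
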